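/- arXiv:2603.08239 — 2 statements merged into one kernel-verified Lean document; each statement's English description precedes it below -/
import Mathlib

section
/- For every u : X → ℝ with Σ_{a∈X} n_a u_a = 0: (1) D(proj(u)) ≤ δ; and (2) if moreover D(u) > δ, then D(proj(u)) < δ (strict inequality). That is, the APC-Obj clipping mechanism projects any violation of the per-state TV budget δ strictly back inside the trust region. -/
open Finset in
/-- For a vector with zero weighted sum, the positive part carries half of the absolute mass. -/
theorem sum_mul_abs_eq_two_mul_sum_mul_max {X : Type*} [Fintype X] (m w : X → ℝ)
    (hw : ∑ a, m a * w a = 0) : ∑ a, m a * |w a| = 2 * ∑ a, m a * max (w a) 0 := by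
  have h : ∑ a, m a * |w a| = ∑ a, (2 * (m a * max (w a) 0) - m a * w a) := by
    refine sum_congr rfl fun a _ => ?_
    rcases le_total (w a) 0 with ha | ha
    · rw [abs_of_nonpos ha, max_eq_right ha]; ring
    · rw [abs_of_nonneg ha, max_eq_left ha]; ring
  rw [h, sum_sub_distrib, hw, sub_zero, mul_sum]

open Finset in
/-- Lowering by `c` removes at least `c` from the weighted positive part, unless it vanishes. -/
theorem two_mul_sum_mul_max_sub_lt {X : Type*} [Fintype X] (m u : X → ℝ) (hm : ∀ a, 1 ≤ m a)
    {c : ℝ} (hc : 0 < c) (h : c < 2 * ∑ a, m a * max (u a) 0) :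
    2 * ∑ a, m a * max (u a - c) 0 < 2 * ∑ a, m a * max (u a) 0 - c := by
  by_cases hex : ∃ a, c < u a
  · obtain ⟨b, hb⟩ := hex
    have hle : c ≤ ∑ a, (m a * max (u a) 0 - m a * max (u a - c) 0) := by
      have hpos : ∀ a ∈ univ, 0 ≤ m a * max (u a) 0 - m a * max (u a - c) 0 := fun a _ => by
        rw [← mul_sub]
        exact mul_nonneg (by linarith [hm a])
          (sub_nonneg.2 (max_le_max_right _ (by linarith)))
      refine le_trans ?_ (single_le_sum hpos (mem_univ b))
      rw [max_eq_left (by linarith), max_eq_left (by linarith)]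
      nlinarith [hm b]
    rw [sum_sub_distrib] at hle
    linarith
  · push Not at hex
    have h0 : ∑ a, m a * max (u a - c) 0 = 0 := sum_eq_zero fun a _ => by
      rw [max_eq_right (by linarith [hex a]), mul_zero]
    linarith

theorem softThreshold_le (x : ℝ) {c : ℝ} (hc : 0 < c) :
    max (-(max (-c + |x|) 0)) (min x (max (-c + |x|) 0)) ≤ max (x - c) 0 := by
  grind

theorem neg_softThreshold_le (x : ℝ) {c : ℝ} (hc : 0 < c) :
    -max (-(max (-c + |x|) 0)) (min x (max (-c + |x|) 0)) ≤ max (-x - c) 0 := by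
  grind

/-- the APC-Obj clipping mechanism (gate, then center) projects
any vector with zero weighted sum back inside the TV trust region of radius
δ, strictly so if the budget was violated. -/
theorem stmt_3 {X : Type} [Fintype X] [Nonempty X]
    (n : X → ℕ) (hn : ∀ a, 1 ≤ n a) (δ : ℝ) (hδ : 0 < δ)
    (u : X → ℝ) (hu : ∑ a, (n a : ℝ) * u a = 0) :
    let T : ℝ := ∑ a, (n a : ℝ)
    let clip : ℝ → ℝ → ℝ := fun x B => max (-(max B 0)) (min x (max B 0))
    let D : (X → ℝ) → ℝ := fun w => (1 / T) * ∑ a, (n a : ℝ) * |w a|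
    let G : X → ℝ := fun a => clip (u a) (T * (δ - D u) + |u a|)
    let vbar : ℝ := (1 / T) * ∑ a, (n a : ℝ) * G a
    let proj : X → ℝ := fun a => G a - vbar
    D proj ≤ δ ∧ (D u > δ → D proj < δ) := by
  intro T clip D G vbar proj
  have hm : ∀ a, (1 : ℝ) ≤ n a := fun a => by exact_mod_cast hn a
  have hT : 0 < T := Finset.sum_pos (fun a _ => by linarith [hm a]) Finset.univ_nonempty
  have hDT : ∀ w, T * D w = ∑ a, (n a : ℝ) * |w a| := fun w => by
    simp only [D]; field_simp
  have hvT : T * vbar = ∑ a, (n a : ℝ) * G a := by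
    simp only [vbar]; field_simp
  have hG : ∀ a, G a = max (-(max (T * (δ - D u) + |u a|) 0))
      (min (u a) (max (T * (δ - D u) + |u a|) 0)) := fun a => rfl
  have hproj : ∀ a, proj a = G a - vbar := fun a => rfl
  rcases le_or_gt (D u) δ with hd | hd
  · have hGu : ∀ a, G a = u a := fun a => by
      have hB : 0 ≤ T * (δ - D u) := mul_nonneg hT.le (sub_nonneg.2 hd)
      rw [hG, max_eq_left (add_nonneg hB (abs_nonneg _)), min_eq_left (by linarith [le_abs_self (u a)]),
        max_eq_right (by linarith [neg_abs_le (u a)])]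
    have hv : vbar = 0 := by simp only [vbar, hGu, hu, mul_zero]
    have hpu : proj = u := funext fun a => by rw [hproj, hGu, hv, sub_zero]
    rw [hpu]
    exact ⟨hd, fun h => absurd hd h.not_ge⟩
  · suffices hlt : D proj < δ from ⟨hlt.le, fun _ => hlt⟩
    obtain ⟨c, hc⟩ : ∃ c, c = T * (D u - δ) := ⟨_, rfl⟩
    have hc0 : 0 < c := hc ▸ mul_pos hT (sub_pos.2 hd)
    have hB : T * (δ - D u) = -c := by rw [hc]; ring
    have hTδ : T * δ = T * D u - c := by rw [hc]; ring
    have hTδ0 : 0 < T * δ := mul_pos hT hδ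
    have hp0 : ∑ a, (n a : ℝ) * proj a = 0 := by
      simp only [hproj, mul_sub, Finset.sum_sub_distrib, ← Finset.sum_mul]
      rw [← hvT]; exact sub_self _
    simp only [hB] at hG
    refine lt_of_mul_lt_mul_left ?_ hT.le
    rw [hTδ, hDT]
    rw [hTδ] at hTδ0
    rw [hDT] at hTδ0 ⊢
    rcases le_total 0 vbar with hv | hv
    · rw [sum_mul_abs_eq_two_mul_sum_mul_max _ _ hu] at hTδ0 ⊢
      rw [sum_mul_abs_eq_two_mul_sum_mul_max _ _ hp0]
      refine lt_of_le_of_lt ?_ (two_mul_sum_mul_max_sub_lt _ u hm hc0 (by linarith))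
      gcongr 2 * ?_
      refine Finset.sum_le_sum fun a _ => mul_le_mul_of_nonneg_left
        (max_le ?_ (le_max_right _ _)) (by linarith [hm a])
      rw [hproj, hG]
      linarith [softThreshold_le (u a) hc0]
    · have hneg : ∀ w : X → ℝ, ∑ a, (n a : ℝ) * w a = 0 →
          ∑ a, (n a : ℝ) * |w a| = 2 * ∑ a, (n a : ℝ) * max (-w a) 0 := fun w hw => by
        simpa using sum_mul_abs_eq_two_mul_sum_mul_max (fun a => (n a : ℝ)) (fun a => -w a)
          (by simpa using hw)
      rw [hneg _ hu] at hTδ0 ⊢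
      rw [hneg _ hp0]
      refine lt_of_le_of_lt ?_
        (two_mul_sum_mul_max_sub_lt _ (fun a => -u a) hm hc0 (by linarith))
      gcongr 2 * ?_
      refine Finset.sum_le_sum fun a _ => mul_le_mul_of_nonneg_left
        (max_le ?_ (le_max_right _ _)) (by linarith [hm a])
      rw [hproj, hG]
      linarith [neg_softThreshold_le (u a) hc0]
end

section
/- Assume M(s) > 0 for every s ∈ S. Then any maximizer Δ* of j over C satisfies max_{s∈S} D̂(s,Δ*) = t* ≤ (1−γ)/(8γ); that is, the sample-based TV-TRPO update lies inside the TV trust region of the TRPO radius δ^TRPO := (1−γ)/(8γ). -/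
/-- A linear functional on weighted zero-sum vectors is bounded by its maximum over the unit sphere
of the weighted `ℓ¹` norm, times that norm. -/
lemma weighted_sum_le_norm_mul_max {α : Type*} [Fintype α] (w b : α → ℝ) (hw : ∀ a, 0 < w a)
    (T : ℝ) (hT : 0 < T) (m : ℝ)
    (hm : ∀ Δ : α → ℝ, (1 / T) * (∑ a, w a * |Δ a|) = 1 → (∑ a, w a * Δ a) = 0 →
      ∑ a, w a * Δ a * b a ≤ m)
    (Δ : α → ℝ) (hΔ : ∑ a, w a * Δ a = 0) :
    ∑ a, w a * Δ a * b a ≤ ((1 / T) * ∑ a, w a * |Δ a|) * m := by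
  have hnn : ∀ a ∈ Finset.univ, 0 ≤ w a * |Δ a| := fun a _ =>
    mul_nonneg (hw a).le (abs_nonneg _)
  rcases (Finset.sum_nonneg hnn).eq_or_lt with h0 | hpos
  · have hz : ∀ a, Δ a = 0 := fun a => by
      have h := (Finset.sum_eq_zero_iff_of_nonneg hnn).1 h0.symm a (Finset.mem_univ a)
      simpa [(hw a).ne'] using h
    simp [hz]
  · set d := (1 / T) * ∑ a, w a * |Δ a| with hd
    have hdpos : 0 < d := by positivity
    have hnorm : (1 / T) * (∑ a, w a * |d⁻¹ * Δ a|) = 1 := by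
      have h : ∑ a, w a * |d⁻¹ * Δ a| = d⁻¹ * ∑ a, w a * |Δ a| := by
        rw [Finset.mul_sum]
        refine Finset.sum_congr rfl fun a _ => ?_
        rw [abs_mul, abs_of_pos (inv_pos.2 hdpos)]
        ring
      rw [h, mul_left_comm, ← hd, inv_mul_cancel₀ hdpos.ne']
    have hzero : ∑ a, w a * (d⁻¹ * Δ a) = 0 := by
      simp_rw [mul_left_comm _ d⁻¹]
      rw [← Finset.mul_sum, hΔ, mul_zero]
    have hval : ∑ a, w a * (d⁻¹ * Δ a) * b a = d⁻¹ * ∑ a, w a * Δ a * b a := by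
      rw [Finset.mul_sum]
      exact Finset.sum_congr rfl fun a _ => by ring
    have h := hm _ hnorm hzero
    rw [hval, inv_mul_le_iff₀ hdpos] at h
    exact h

/-- A weighted sum is at most the weighted `ℓ¹` norm times a uniform bound. -/
lemma weighted_sum_le_mul_bound {α : Type*} [Fintype α] (w b Δ : α → ℝ) (hw : ∀ a, 0 < w a)
    (B : ℝ) (hB : ∀ a, |b a| ≤ B) :
    ∑ a, w a * Δ a * b a ≤ (∑ a, w a * |Δ a|) * B := by
  rw [Finset.sum_mul]
  refine Finset.sum_le_sum fun a _ => ?_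
  rw [mul_assoc, mul_assoc]
  refine mul_le_mul_of_nonneg_left ?_ (hw a).le
  calc Δ a * b a ≤ |Δ a * b a| := le_abs_self _
    _ = |Δ a| * |b a| := abs_mul _ _
    _ ≤ |Δ a| * B := mul_le_mul_of_nonneg_left (hB a) (abs_nonneg _)


/-- any maximizer of the reduced sample-based TV-TRPO objective
over the zero-sum set has max per-state TV divergence equal to t*, which is
at most the TRPO trust-region radius (1−γ)/(8γ). -/
theorem stmt_5 {S : Type} [Fintype S] [Nonempty S]
    (X : S → Type) [∀ s, Fintype (X s)]
    (hX : ∀ s, 2 ≤ Fintype.card (X s))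
    (n : ∀ s, X s → ℕ) (hn : ∀ s a, 1 ≤ n s a)
    (A : ∀ s, X s → ℝ)
    (Anorm : ℝ) (hA : IsGreatest {x : ℝ | ∃ s, ∃ a : X s, x = |A s a|} Anorm)
    (hApos : 0 < Anorm)
    (Γ : S → ℝ) (hΓ : ∀ s, 0 < Γ s)
    (γ : ℝ) (hγ0 : 0 < γ) (hγ1 : γ < 1)
    (M : S → ℝ)
    (hM : ∀ s, IsGreatest {y : ℝ | ∃ Δ : X s → ℝ,
        (1 / (∑ a, (n s a : ℝ))) * (∑ a, (n s a : ℝ) * |Δ a|) = 1 ∧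
        (∑ a, (n s a : ℝ) * Δ a) = 0 ∧
        y = ∑ a, (n s a : ℝ) * Δ a * A s a} (M s))
    (hMpos : ∀ s, 0 < M s) :
    let Ts : S → ℝ := fun s => ∑ a, (n s a : ℝ)
    let Γtot : ℝ := ∑ s, Γ s
    let Mtot : ℝ := (1 / Γtot) * ∑ s, (Γ s / Ts s) * M s
    let tstar : ℝ := (1 - γ) * Mtot / (8 * γ * Anorm)
    let Dhat : S → (∀ s', X s' → ℝ) → ℝ :=
      fun s Δ => (1 / Ts s) * ∑ a, (n s a : ℝ) * |Δ s a|
    let C : Set (∀ s, X s → ℝ) := {Δ | ∀ s, ∑ a, (n s a : ℝ) * Δ s a = 0}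
    let j : (∀ s, X s → ℝ) → ℝ := fun Δ =>
      (1 / ((1 - γ) * Γtot)) * ∑ s, (Γ s / Ts s) * ∑ a, (n s a : ℝ) * Δ s a * A s a
      - (4 * γ * Anorm / (1 - γ) ^ 2) *
          (Finset.univ.sup' Finset.univ_nonempty (fun s => Dhat s Δ)) ^ 2
    ∀ Δstar ∈ C, (∀ Δ' ∈ C, j Δ' ≤ j Δstar) →
      Finset.univ.sup' Finset.univ_nonempty (fun s => Dhat s Δstar) = tstar ∧
      tstar ≤ (1 - γ) / (8 * γ) := by
  intro Ts Γtot Mtot tstar Dhat C j Δstar hΔC hmax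
  have hw : ∀ s a, (0 : ℝ) < n s a := fun s a => by exact_mod_cast hn s a
  have hT : ∀ s, 0 < Ts s := fun s => by
    have : Nonempty (X s) := Fintype.card_pos_iff.1 (by have := hX s; omega)
    exact Finset.sum_pos (fun a _ => hw s a) Finset.univ_nonempty
  have hΓtot : 0 < Γtot := Finset.sum_pos (fun s _ => hΓ s) Finset.univ_nonempty
  have hMtot : 0 < Mtot := mul_pos (one_div_pos.2 hΓtot)
    (Finset.sum_pos (fun s _ => mul_pos (div_pos (hΓ s) (hT s)) (hMpos s)) Finset.univ_nonempty)
  have h1γ : 0 < 1 - γ := sub_pos.2 hγ1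
  have htpos : 0 < tstar := by positivity
  have hMsum : ∑ s, (Γ s / Ts s) * M s = Γtot * Mtot := by
    simp only [Mtot]
    field_simp
  have hMle : ∀ s, M s ≤ Ts s * Anorm := fun s => by
    obtain ⟨Δ, h1, -, h3⟩ := (hM s).1
    rw [h3]
    refine (weighted_sum_le_mul_bound (fun a => (n s a : ℝ)) (A s) Δ (hw s) Anorm
      fun a => hA.2 ⟨s, a, rfl⟩).trans (le_of_eq ?_)
    congr 1
    have hTs := (hT s).ne'
    change 1 / Ts s * _ = 1 at h1
    field_simp at h1
    exact h1
  have hMtot_le : Mtot ≤ Anorm := by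
    have h : ∑ s, (Γ s / Ts s) * M s ≤ Γtot * Anorm := by
      rw [Finset.sum_mul]
      refine Finset.sum_le_sum fun s _ => ?_
      rw [div_mul_eq_mul_div, div_le_iff₀ (hT s)]
      nlinarith [mul_le_mul_of_nonneg_left (hMle s) (hΓ s).le]
    rw [hMsum] at h
    exact le_of_mul_le_mul_left h hΓtot
  refine ⟨?_, ?_⟩
  · set D := Finset.univ.sup' Finset.univ_nonempty (fun s => Dhat s Δstar) with hD
    have hlin : ∑ s, (Γ s / Ts s) * ∑ a, (n s a : ℝ) * Δstar s a * A s a ≤ Γtot * Mtot * D := by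
      rw [← hMsum, Finset.sum_mul]
      refine Finset.sum_le_sum fun s _ => ?_
      rw [mul_assoc]
      refine mul_le_mul_of_nonneg_left ?_ (div_pos (hΓ s) (hT s)).le
      refine (weighted_sum_le_norm_mul_max (fun a => (n s a : ℝ)) (A s) (hw s) (Ts s) (hT s) (M s)
        (fun Δ h1 h2 => (hM s).2 ⟨Δ, h1, h2, rfl⟩) (Δstar s) (hΔC s)).trans ?_
      rw [mul_comm (M s)]
      refine mul_le_mul_of_nonneg_right ?_ (hMpos s).le
      exact Finset.le_sup' (fun s => Dhat s Δstar) (Finset.mem_univ s)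
    choose E hE1 hE2 hE3 using fun s => (hM s).1
    let Δ' : ∀ s, X s → ℝ := fun s a => tstar * E s a
    have hΔ'C : Δ' ∈ C := fun s => by
      simp only [Δ', mul_left_comm _ tstar]
      rw [← Finset.mul_sum, hE2, mul_zero]
    have hΔ'D : ∀ s, Dhat s Δ' = tstar := fun s => by
      simp only [Dhat, Δ', abs_mul, abs_of_pos htpos, mul_left_comm _ tstar]
      rw [← Finset.mul_sum, mul_left_comm, hE1, mul_one]
    have hΔ'sup : Finset.univ.sup' Finset.univ_nonempty (fun s => Dhat s Δ') = tstar := by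
      simp only [hΔ'D, Finset.sup'_const]
    have hΔ'lin : ∑ s, (Γ s / Ts s) * ∑ a, (n s a : ℝ) * Δ' s a * A s a =
        Γtot * Mtot * tstar := by
      rw [← hMsum, Finset.sum_mul]
      refine Finset.sum_congr rfl fun s _ => ?_
      rw [hE3 s, mul_assoc, Finset.sum_mul]
      congr 1
      exact Finset.sum_congr rfl fun a _ => by simp only [Δ']; ring
    have hopt := hmax Δ' hΔ'C
    simp only [j] at hopt
    rw [hΔ'sup, hΔ'lin, ← hD] at hopt
    have hk : 0 < 1 / ((1 - γ) * Γtot) := by positivity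
    have hub := mul_le_mul_of_nonneg_left hlin hk.le
    set c := 4 * γ * Anorm / (1 - γ) ^ 2 with hc
    have hcpos : 0 < c := by positivity
    have hcoef : ∀ x, 1 / ((1 - γ) * Γtot) * (Γtot * Mtot * x) = 2 * c * tstar * x := fun x => by
      simp only [hc, tstar]
      field_simp
      ring
    rw [hcoef] at hub hopt
    have hsq : c * (D - tstar) ^ 2 ≤ 0 := by nlinarith
    have hsq0 : (D - tstar) ^ 2 = 0 :=
      le_antisymm (nonpos_of_mul_nonpos_right hsq hcpos) (sq_nonneg _)
    exact sub_eq_zero.1 (pow_eq_zero_iff two_ne_zero |>.1 hsq0)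
  · simp only [tstar]
    rw [div_le_div_iff₀ (by positivity) (by positivity)]
    nlinarith [mul_le_mul_of_nonneg_left hMtot_le (mul_pos h1γ hγ0).le]
end
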